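/- arXiv:2401.15718 — 2 statements merged into one kernel-verified Lean document; each statement's English description precedes it below -/
import Mathlib

section
/- Let D be a finite distributive lattice, graded by the rank function r (the height function), and let A = {x ∈ D : r(x) = i} and B = {x ∈ D : r(x) = j} be two distinct levels of D satisfying A ≤ B and |A|, |B| > 1. Then the convex set [A, B] = {x : ∃ a ∈ A, ∃ b ∈ B, a ≤ x ≤ b} is the union of at most |A|·|B| − min(|A|, |B|) closed intervals [a, b] with a ∈ A, b ∈ B if |A| ≠ |B| or |A| = |B| is even, and of at most |A|·|B| − min(|A|, |B|) + 1 such intervals if |A| = |B| is odd. -/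
/-- The order-theoretic properties of a level of a graded lattice that the argument uses;
they are invariant under reversing the order. -/
structure IsLevelLike {D : Type*} [Lattice D] (S : Set D) : Prop where
  antichain : ∀ s ∈ S, ∀ t ∈ S, s ≤ t → s = t
  interpolate : ∀ s ∈ S, ∀ t ∈ S, ∀ u v : D, u ≤ v → u ≤ s → t ≤ v → ∃ w ∈ S, u ≤ w ∧ w ≤ v
  comparable : ∀ z : D, ∃ s ∈ S, z ≤ s ∨ s ≤ z

/-- Some element `x` of `[a, b]` lies in no other interval from `A` to `B`. -/
def IsEssential {D : Type*} [Lattice D] (A B : Set D) (a b : D) : Prop :=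
  ∃ x, a ≤ x ∧ x ≤ b ∧ (∀ a' ∈ A, a' ≤ x → a' = a) ∧ ∀ b' ∈ B, x ≤ b' → b' = b

lemma IsLevelLike.dual {D : Type*} [Lattice D] {S : Set D} (h : IsLevelLike S) :
    IsLevelLike (D := Dᵒᵈ) (OrderDual.ofDual ⁻¹' S) where
  antichain s hs t ht hst := (h.antichain t ht s hs hst).symm
  interpolate s hs t ht u v huv hus htv := by
    obtain ⟨w, hw, h₁, h₂⟩ := h.interpolate t ht s hs v u huv htv hus
    exact ⟨w, hw, h₂, h₁⟩
  comparable z := by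
    obtain ⟨s, hs, h'⟩ := h.comparable z
    exact ⟨s, hs, h'.symm⟩

lemma IsEssential.dual {D : Type*} [Lattice D] {A B : Set D} {a b : D}
    (h : IsEssential A B a b) :
    IsEssential (D := Dᵒᵈ) (OrderDual.ofDual ⁻¹' B) (OrderDual.ofDual ⁻¹' A)
      (OrderDual.toDual b) (OrderDual.toDual a) := by
  obtain ⟨x, h₁, h₂, h₃, h₄⟩ := h
  exact ⟨x, h₂, h₁, h₄, h₃⟩

/-- If two essential intervals share the bottom `a`, then `a` is the only element of `A`
below either of their tops. -/
lemma IsEssential.eq_of_le_top {D : Type*} [DistribLattice D] {A B : Set D}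
    (hA : IsLevelLike A) (hB : IsLevelLike B) {a a' b b' : D}
    (ha : a ∈ A) (ha' : a' ∈ A) (hb : b ∈ B) (hbb' : b ≠ b')
    (h : IsEssential A B a b) (h' : IsEssential A B a b') (hle : a' ≤ b) : a' = a := by
  obtain ⟨x, hax, hxb, hxA, hxB⟩ := h
  obtain ⟨y, hay, hyb', hyA, hyB⟩ := h'
  have hbxy : b ≤ x ⊔ y := by
    obtain ⟨c, hc, hzc | hcz⟩ := hB.comparable (x ⊔ y)
    · exact (hbb' ((hxB c hc (le_sup_left.trans hzc)).symm.trans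
        (hyB c hc (le_sup_right.trans hzc)))).elim
    · obtain ⟨w, hw, hxw, hwz⟩ := hB.interpolate b hb c hc x (x ⊔ y) le_sup_left hxb hcz
      exact hxB w hw hxw ▸ hwz
  have hinf : ∀ z, a ≤ z → (∀ c ∈ A, c ≤ z → c = a) → z ⊓ a' ≤ a := by
    intro z haz hz
    obtain ⟨w, hw, h₁, h₂⟩ :=
      hA.interpolate a' ha' a ha (z ⊓ a') z inf_le_left inf_le_right haz
    exact hz w hw h₂ ▸ h₁
  refine hA.antichain a' ha' a ha ?_
  calc a' = (x ⊔ y) ⊓ a' := (inf_eq_right.2 (hle.trans hbxy)).symm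
    _ = x ⊓ a' ⊔ y ⊓ a' := inf_sup_right ..
    _ ≤ a := sup_le (hinf x hax hxA) (hinf y hay hyA)

lemma IsEssential.eq_of_bot_le {D : Type*} [DistribLattice D] {A B : Set D}
    (hA : IsLevelLike A) (hB : IsLevelLike B) {a a' b b' : D}
    (ha : a ∈ A) (hb : b ∈ B) (hb' : b' ∈ B) (haa' : a ≠ a')
    (h : IsEssential A B a b) (h' : IsEssential A B a' b) (hle : a ≤ b') : b' = b :=
  IsEssential.eq_of_le_top (D := Dᵒᵈ) hB.dual hA.dual hb hb' ha haa' h.dual h'.dual hle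

lemma exists_between_of_rank {D : Type*} [PartialOrder D] [Fintype D] {r : D → ℕ}
    (hrcov : ∀ x y : D, x ⋖ y → r y = r x + 1) {u v : D} (huv : u ≤ v) {k : ℕ}
    (hu : r u ≤ k) (hv : k ≤ r v) : ∃ w, r w = k ∧ u ≤ w ∧ w ≤ v := by
  induction k, hu using Nat.le_induction with
  | base => exact ⟨u, rfl, le_rfl, huv⟩
  | succ k hk ih =>
    obtain ⟨w, hw, huw, hwv⟩ := ih (by omega)
    have hlt : w < v := lt_of_le_of_ne hwv (by rintro rfl; omega)
    obtain ⟨c, hwc, hcv⟩ := exists_covBy_le_of_lt hlt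
    exact ⟨c, by rw [hrcov w c hwc, hw], huw.trans hwc.le, hcv⟩

lemma strictMono_of_rank {D : Type*} [PartialOrder D] [Fintype D] {r : D → ℕ}
    (hrcov : ∀ x y : D, x ⋖ y → r y = r x + 1) : StrictMono r := by
  classical
  let := Fintype.toLocallyFiniteOrder (α := D)
  intro x y hxy
  have hgen := transGen_covBy_of_lt hxy
  clear hxy
  induction hgen with
  | single h => rw [hrcov _ _ h]; omega
  | tail _ h ih => rw [hrcov _ _ h]; omega

lemma isLevelLike_of_rank {D : Type*} [Lattice D] [Fintype D] [BoundedOrder D] {r : D → ℕ}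
    (hr0 : r ⊥ = 0) (hrcov : ∀ x y : D, x ⋖ y → r y = r x + 1) {k : ℕ}
    (hne : {x | r x = k}.Nonempty) : IsLevelLike {x | r x = k} where
  antichain s hs t ht hst := by
    by_contra hne
    have := strictMono_of_rank hrcov (lt_of_le_of_ne hst hne)
    simp only [Set.mem_ofPred_eq] at hs ht
    omega
  interpolate s hs t ht u v huv hus htv := by
    have hm := (strictMono_of_rank hrcov).monotone
    exact exists_between_of_rank hrcov huv ((hm hus).trans_eq hs) (ht.symm.trans_le (hm htv))
  comparable z := by
    have hm := (strictMono_of_rank hrcov).monotone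
    obtain ⟨s, hs⟩ := hne
    rcases le_total (r z) k with h | h
    · obtain ⟨w, hw, h₁, -⟩ := exists_between_of_rank hrcov (le_top : z ≤ ⊤) h
        (hs.symm.trans_le (hm le_top))
      exact ⟨w, hw, .inl h₁⟩
    · obtain ⟨w, hw, -, h₂⟩ := exists_between_of_rank hrcov (bot_le : ⊥ ≤ z) (by omega) h
      exact ⟨w, hw, .inr h₂⟩

/-- A relation containing no full row, no full column and no complete bipartite graph on two
plus two vertices can be avoided by an injection. -/
lemma exists_injective_avoiding {α β : Type*} [Fintype α] [Fintype β] (R : α → β → Prop)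
    (hcard : Fintype.card α ≤ Fintype.card β) (hrow : ∀ a, ∃ b, ¬ R a b)
    (hcol : ∀ b, ∃ a, ¬ R a b)
    (hsq : ∀ a a' b b', a ≠ a' → b ≠ b' → R a b → R a b' → R a' b → ¬ R a' b') :
    ∃ f : α → β, Function.Injective f ∧ ∀ a, ¬ R a (f a) := by
  classical
  refine (Fintype.all_card_le_filter_rel_iff_exists_injective fun a b => ¬ R a b).1 fun S => ?_
  by_contra! hlt
  set N : Finset β := {b | ∃ a ∈ S, ¬ R a b}
  have hN : ∀ b ∈ Nᶜ, ∀ a ∈ S, R a b := by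
    intro b hb a ha
    by_contra h
    simp only [N, Finset.mem_compl, Finset.mem_filter, Finset.mem_univ, true_and] at hb
    exact hb ⟨a, ha, h⟩
  have hcompl : Nᶜ.card + N.card = Fintype.card β := by
    rw [add_comm, Finset.card_add_card_compl]
  have hS := S.card_le_univ
  obtain hS1 | hS1 := le_or_gt S.card 1
  · have hN0 : Nᶜ = Finset.univ := by
      rw [← Finset.card_eq_iff_eq_univ]; omega
    obtain ⟨a, ha⟩ := Finset.card_pos.1 (by omega : 0 < S.card)
    obtain ⟨b, hb⟩ := hrow a
    exact hb (hN b (hN0 ▸ Finset.mem_univ b) a ha)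
  obtain ⟨a, ha, a', ha', haa'⟩ := Finset.one_lt_card.1 hS1
  obtain hT | hT := le_or_gt Nᶜ.card 1
  · have hSu : S = Finset.univ := by
      rw [← Finset.card_eq_iff_eq_univ]; omega
    obtain ⟨b, hb⟩ := Finset.card_pos.1 (by omega : 0 < Nᶜ.card)
    obtain ⟨c, hc⟩ := hcol b
    exact hc (hN b hb c (hSu ▸ Finset.mem_univ c))
  obtain ⟨b, hb, b', hb', hbb'⟩ := Finset.one_lt_card.1 hT
  exact hsq a a' b b' haa' hbb' (hN b hb a ha) (hN b' hb' a ha) (hN b hb a' ha')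
    (hN b' hb' a' ha')

/-- A relation with no full row, no full column and no complete bipartite graph on two plus two
vertices is avoided by some matching saturating the smaller side. -/
lemma exists_matching_avoiding {α β : Type*} [Fintype α] [Fintype β] (R : α → β → Prop)
    (hrow : ∀ a, ∃ b, ¬ R a b) (hcol : ∀ b, ∃ a, ¬ R a b)
    (hsq : ∀ a a' b b', a ≠ a' → b ≠ b' → R a b → R a b' → R a' b → ¬ R a' b') :
    ∃ M : Finset (α × β), M.card = min (Fintype.card α) (Fintype.card β) ∧
      (∀ p ∈ M, ¬ R p.1 p.2) ∧ (∀ p ∈ M, ∀ q ∈ M, p.1 = q.1 → p = q) ∧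
      ∀ p ∈ M, ∀ q ∈ M, p.2 = q.2 → p = q := by
  classical
  rcases le_total (Fintype.card α) (Fintype.card β) with h | h
  · obtain ⟨f, hf, hR⟩ := exists_injective_avoiding R h hrow hcol hsq
    refine ⟨Finset.univ.image fun a => (a, f a), ?_, ?_, ?_, ?_⟩
    · rw [Finset.card_image_of_injective _ fun a b hab => congrArg Prod.fst hab,
        Finset.card_univ, min_eq_left h]
    · simpa using hR
    · simp
    · simp only [Finset.mem_image, Finset.mem_univ, true_and]
      rintro _ ⟨a, rfl⟩ _ ⟨b, rfl⟩ hab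
      rw [hf hab]
  · obtain ⟨f, hf, hR⟩ := exists_injective_avoiding (fun b a => R a b) h hcol hrow
      fun b b' a a' hb ha h₁ h₂ h₃ => hsq a a' b b' ha hb h₁ h₃ h₂
    refine ⟨Finset.univ.image fun b => (f b, b), ?_, ?_, ?_, ?_⟩
    · rw [Finset.card_image_of_injective _ fun a b hab => congrArg Prod.snd hab,
        Finset.card_univ, min_eq_right h]
    · simpa using hR
    · simp only [Finset.mem_image, Finset.mem_univ, true_and]
      rintro _ ⟨a, rfl⟩ _ ⟨b, rfl⟩ hab
      rw [hf hab]
    · simp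

/-- **Theorem 4.** Let `D` be a finite distributive lattice graded by the rank
function `r`, with distinct levels `A` and `B` satisfying `A ≤ B` and
`|A|, |B| > 1`. Then `[A, B]` has a cover by at most
`|A|⬝|B| - min(|A|,|B|)` intervals if `|A| ≠ |B|` or `|A| = |B|` is even, and by at
most `|A|⬝|B| - min(|A|,|B|) + 1` intervals if `|A| = |B|` is odd. -/
theorem stmt4 {D : Type*} [DistribLattice D] [Fintype D] [BoundedOrder D]
    (r : D → ℕ) (hr0 : r ⊥ = 0) (hrcov : ∀ x y : D, x ⋖ y → r y = r x + 1)
    (i j : ℕ) (hij : i ≠ j)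
    (A B : Set D) (hA : A = {x : D | r x = i}) (hB : B = {x : D | r x = j})
    (hle₁ : ∀ a ∈ A, ∃ b ∈ B, a ≤ b) (hle₂ : ∀ b ∈ B, ∃ a ∈ A, a ≤ b)
    (hAcard : 1 < A.ncard) (hBcard : 1 < B.ncard) :
    ∃ F : Finset (D × D),
      F.card ≤ (if A.ncard = B.ncard ∧ Odd A.ncard then
          A.ncard * B.ncard - min A.ncard B.ncard + 1
        else A.ncard * B.ncard - min A.ncard B.ncard) ∧
      (∀ p ∈ F, p.1 ∈ A ∧ p.2 ∈ B) ∧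
      (⋃ p ∈ F, Set.Icc p.1 p.2) = {x : D | ∃ a ∈ A, ∃ b ∈ B, a ≤ x ∧ x ≤ b} := by
  classical
  have hlA : IsLevelLike A := by
    rw [hA]
    exact isLevelLike_of_rank hr0 hrcov (hA ▸ Set.nonempty_of_ncard_ne_zero (by omega))
  have hlB : IsLevelLike B := by
    rw [hB]
    exact isLevelLike_of_rank hr0 hrcov (hB ▸ Set.nonempty_of_ncard_ne_zero (by omega))
  obtain ⟨M, hMcard, hMR, hM₁, hM₂⟩ :=
    exists_matching_avoiding (fun (a : A) (b : B) => IsEssential A B (a : D) b)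
      (by
        by_contra! ⟨a, ha⟩
        obtain ⟨a', ha', hne⟩ := Set.exists_ne_of_one_lt_ncard hAcard (a : D)
        obtain ⟨b, hb, hab⟩ := hle₁ a' ha'
        obtain ⟨b', hb', hne'⟩ := Set.exists_ne_of_one_lt_ncard hBcard b
        exact hne ((ha ⟨b, hb⟩).eq_of_le_top hlA hlB a.2 ha' hb hne'.symm (ha ⟨b', hb'⟩) hab))
      (by
        by_contra! ⟨b, hb⟩
        obtain ⟨b', hb', hne⟩ := Set.exists_ne_of_one_lt_ncard hBcard (b : D)
        obtain ⟨a, ha, hab⟩ := hle₂ b' hb'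
        obtain ⟨a', ha', hne'⟩ := Set.exists_ne_of_one_lt_ncard hAcard a
        exact hne ((hb ⟨a, ha⟩).eq_of_bot_le hlA hlB ha b.2 hb' hne'.symm (hb ⟨a', ha'⟩) hab))
      (by
        intro a a' b b' ha hb h₁ h₂ ⟨x, hax, hxb, _⟩ _
        exact ha (Subtype.ext (h₁.eq_of_le_top hlA hlB a.2 a'.2 b.2
          (fun h => hb (Subtype.ext h)) h₂ (hax.trans hxb))).symm)
  refine ⟨Mᶜ.map ((Function.Embedding.subtype (· ∈ A)).prodMap
    (Function.Embedding.subtype (· ∈ B))), ?_, ?_, ?_⟩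
  · have hcard : Mᶜ.card = A.ncard * B.ncard - min A.ncard B.ncard := by
      rw [Finset.card_compl, hMcard, Fintype.card_prod, Fintype.card_eq_nat_card,
        Fintype.card_eq_nat_card, Nat.card_coe_set_eq, Nat.card_coe_set_eq]
    rw [Finset.card_map, hcard]
    split_ifs <;> omega
  · simp only [Finset.mem_map]
    rintro _ ⟨p, -, rfl⟩
    exact ⟨p.1.2, p.2.2⟩
  · ext x
    simp only [Set.mem_iUnion, Finset.mem_map, Set.mem_ofPred_eq, exists_prop]
    constructor
    · rintro ⟨_, ⟨p, -, rfl⟩, hx⟩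
      exact ⟨p.1, p.1.2, p.2, p.2.2, hx⟩
    · rintro ⟨a, ha, b, hb, hax, hxb⟩
      by_contra! hcon
      have hmem : ∀ (a' : A) (b' : B), (a' : D) ≤ x → x ≤ b' → (a', b') ∈ M := by
        intro a' b' h₁ h₂
        by_contra h
        exact hcon _ ⟨(a', b'), Finset.mem_compl.2 h, rfl⟩ ⟨h₁, h₂⟩
      have hab := hmem ⟨a, ha⟩ ⟨b, hb⟩ hax hxb
      refine hMR _ hab ⟨x, hax, hxb, fun a' ha' h => ?_, fun b' hb' h => ?_⟩
      · exact congrArg (fun p => (p.1 : D)) (hM₂ _ (hmem ⟨a', ha'⟩ ⟨b, hb⟩ h hxb) _ hab rfl)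
      · exact congrArg (fun p => (p.2 : D)) (hM₁ _ (hmem ⟨a, ha⟩ ⟨b', hb'⟩ hax h) _ hab rfl)
end

section
/- For all integers r, s ≥ 1 there exists a finite lattice L (with bottom 0 and top 1) whose set A of atoms has cardinality r and whose set C of coatoms has cardinality s, such that every family of intervals [a, c] with a ∈ A, c ∈ C whose union contains the convex set [A, C] = {x : ∃ a ∈ A, ∃ c ∈ C, a ≤ x ≤ c} has at least r·s members. -/
/-- The elements of a lattice with atoms `α` and coatoms `β`: besides the bounds, it has one element
above all the atoms and below all the coatoms, and for each `i : α` and `j : β` one element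
`mid i j` whose only atom is `atom i` and whose only coatom is `coatom j`. -/
inductive GridLattice (α β : Type) : Type
  | bot : GridLattice α β
  | atom (i : α) : GridLattice α β
  | mid (i : α) (j : β) : GridLattice α β
  | centre : GridLattice α β
  | coatom (j : β) : GridLattice α β
  | top : GridLattice α β

namespace GridLattice

variable {α β : Type}

instance [Finite α] [Finite β] : Finite (GridLattice α β) := by
  let f : Fin 3 ⊕ α ⊕ β ⊕ α × β → GridLattice α β :=
    Sum.elim ![bot, centre, top] (Sum.elim atom (Sum.elim coatom fun p => mid p.1 p.2))
  refine Finite.of_surjective f fun x => ?_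
  cases x with
  | bot => exact ⟨.inl 0, rfl⟩
  | atom i => exact ⟨.inr (.inl i), rfl⟩
  | mid i j => exact ⟨.inr (.inr (.inr (i, j))), rfl⟩
  | centre => exact ⟨.inl 1, rfl⟩
  | coatom j => exact ⟨.inr (.inr (.inl j)), rfl⟩
  | top => exact ⟨.inl 2, rfl⟩

/-- The order relation of `GridLattice α β`. -/
def le : GridLattice α β → GridLattice α β → Prop
  | bot, _ => True
  | _, top => True
  | atom i, atom k => i = k
  | atom i, mid k _ => i = k
  | atom _, centre => True
  | atom _, coatom _ => True
  | mid i j, mid k l => i = k ∧ j = l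
  | mid _ j, coatom l => j = l
  | centre, centre => True
  | centre, coatom _ => True
  | coatom j, coatom l => j = l
  | _, _ => False

instance : PartialOrder (GridLattice α β) where
  le := le
  le_refl x := by cases x <;> simp [le]
  le_trans x y z := by cases x <;> cases y <;> cases z <;> simp +contextual [le]
  le_antisymm x y := by cases x <;> cases y <;> simp +contextual [le]

theorem le_def (x y : GridLattice α β) : x ≤ y ↔ le x y := Iff.rfl

instance : BoundedOrder (GridLattice α β) where
  bot := bot
  bot_le x := by cases x <;> simp [le_def, le]
  top := top
  le_top x := by cases x <;> simp [le_def, le]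

theorem bot_def : (⊥ : GridLattice α β) = bot := rfl

theorem top_def : (⊤ : GridLattice α β) = top := rfl

open Classical in
/-- The meet of two elements of `GridLattice α β`. -/
noncomputable def meet : GridLattice α β → GridLattice α β → GridLattice α β
  | bot, _ => bot
  | _, bot => bot
  | top, y => y
  | x, top => x
  | atom i, atom k => if i = k then atom i else bot
  | atom i, mid k _ => if i = k then atom i else bot
  | mid i _, atom k => if i = k then atom i else bot
  | atom i, centre => atom i
  | centre, atom i => atom i
  | atom i, coatom _ => atom i
  | coatom _, atom i => atom i
  | mid i j, mid k l => if i = k then (if j = l then mid i j else atom i) else bot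
  | mid i _, centre => atom i
  | centre, mid i _ => atom i
  | mid i j, coatom l => if j = l then mid i j else atom i
  | coatom l, mid i j => if j = l then mid i j else atom i
  | centre, centre => centre
  | centre, coatom _ => centre
  | coatom _, centre => centre
  | coatom j, coatom l => if j = l then coatom j else centre

open Classical in
/-- The join of two elements of `GridLattice α β`. -/
noncomputable def join : GridLattice α β → GridLattice α β → GridLattice α β
  | top, _ => top
  | _, top => top
  | bot, y => y
  | x, bot => x
  | coatom j, coatom l => if j = l then coatom j else top
  | coatom j, mid _ l => if j = l then coatom j else top
  | mid _ j, coatom l => if j = l then coatom j else top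
  | coatom j, centre => coatom j
  | centre, coatom j => coatom j
  | coatom j, atom _ => coatom j
  | atom _, coatom j => coatom j
  | mid i j, mid k l => if j = l then (if i = k then mid i j else coatom j) else top
  | mid _ j, centre => coatom j
  | centre, mid _ j => coatom j
  | mid i j, atom k => if i = k then mid i j else coatom j
  | atom k, mid i j => if i = k then mid i j else coatom j
  | centre, centre => centre
  | centre, atom _ => centre
  | atom _, centre => centre
  | atom i, atom k => if i = k then atom i else centre

noncomputable instance : Lattice (GridLattice α β) where
  inf := meet
  sup := join
  inf_le_left x y := by
    cases x <;> cases y <;> simp only [meet, le_def] <;> (try split_ifs) <;> simp_all [le]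
  inf_le_right x y := by
    cases x <;> cases y <;> simp only [meet, le_def] <;> (try split_ifs) <;> simp_all [le]
  le_inf x y z := by
    cases x <;> cases y <;> cases z <;> simp only [meet, le_def] <;> (try split_ifs) <;>
      simp only [le] <;> grind
  le_sup_left x y := by
    cases x <;> cases y <;> simp only [join, le_def] <;> (try split_ifs) <;> simp_all [le]
  le_sup_right x y := by
    cases x <;> cases y <;> simp only [join, le_def] <;> (try split_ifs) <;> simp_all [le]
  sup_le x y z := by
    cases x <;> cases y <;> cases z <;> simp only [join, le_def] <;> (try split_ifs) <;>
      simp only [le] <;> grind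

theorem isAtom_iff [Nonempty α] {x : GridLattice α β} : IsAtom x ↔ ∃ i, x = atom i := by
  rw [isAtom_iff_le_of_ge]
  constructor
  · rintro ⟨h0, h⟩
    obtain ⟨k⟩ := ‹Nonempty α›
    cases x with
    | bot => exact absurd rfl h0
    | atom i => exact ⟨i, rfl⟩
    | mid i j => simpa [le_def, le, bot_def] using h (atom i)
    | _ => simpa [le_def, le, bot_def] using h (atom k)
  · rintro ⟨i, rfl⟩
    refine ⟨by simp [bot_def], fun y => ?_⟩
    cases y <;> simp +contextual [le_def, le, bot_def]

theorem isCoatom_iff [Nonempty β] {x : GridLattice α β} : IsCoatom x ↔ ∃ j, x = coatom j := by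
  rw [isCoatom_iff_ge_of_le]
  constructor
  · rintro ⟨h1, h⟩
    obtain ⟨k⟩ := ‹Nonempty β›
    cases x with
    | top => exact absurd rfl h1
    | coatom j => exact ⟨j, rfl⟩
    | mid i j => simpa [le_def, le, top_def] using h (coatom j)
    | _ => simpa [le_def, le, top_def] using h (coatom k)
  · rintro ⟨j, rfl⟩
    refine ⟨by simp [top_def], fun y => ?_⟩
    cases y <;> simp +contextual [le_def, le, top_def]

theorem ncard_isAtom [Nonempty α] : {a : GridLattice α β | IsAtom a}.ncard = Nat.card α := by
  have h : {a : GridLattice α β | IsAtom a} = Set.range atom := by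
    ext x
    simp [isAtom_iff, eq_comm]
  rw [h, Set.ncard_range_of_injective fun _ _ => atom.inj]

theorem ncard_isCoatom [Nonempty β] : {c : GridLattice α β | IsCoatom c}.ncard = Nat.card β := by
  have h : {c : GridLattice α β | IsCoatom c} = Set.range coatom := by
    ext x
    simp [isCoatom_iff, eq_comm]
  rw [h, Set.ncard_range_of_injective fun _ _ => coatom.inj]

/-- A family of atom–coatom intervals that covers the convex set between the atoms and the coatoms
contains every such interval. -/
theorem mem_of_cover [Nonempty α] [Nonempty β] {F : Finset (GridLattice α β × GridLattice α β)}
    (hF : ∀ p ∈ F, IsAtom p.1 ∧ IsCoatom p.2)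
    (hcover : {x : GridLattice α β | ∃ a, IsAtom a ∧ ∃ c, IsCoatom c ∧ a ≤ x ∧ x ≤ c} ⊆
      ⋃ p ∈ F, Set.Icc p.1 p.2) (i : α) (j : β) : (atom i, coatom j) ∈ F := by
  have hmem : mid i j ∈ ⋃ p ∈ F, Set.Icc p.1 p.2 :=
    hcover ⟨atom i, isAtom_iff.2 ⟨i, rfl⟩, coatom j, isCoatom_iff.2 ⟨j, rfl⟩,
      by simp [le_def, le], by simp [le_def, le]⟩
  simp only [Set.mem_iUnion] at hmem
  obtain ⟨⟨a, c⟩, hp, hle⟩ := hmem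
  obtain ⟨ha, hc⟩ := hF _ hp
  obtain ⟨k, rfl⟩ := isAtom_iff.1 ha
  obtain ⟨l, rfl⟩ := isCoatom_iff.1 hc
  obtain ⟨rfl, rfl⟩ : k = i ∧ j = l := hle
  exact hp

end GridLattice


/-- For all `r, s ≥ 1` there is a finite (bounded) lattice `L` with `r` atoms and
`s` coatoms such that every family of atom–coatom intervals covering the convex
set `[A, C]` between the atoms and the coatoms has at least `r⬝s` members. -/
theorem stmt12 (r s : ℕ) (hr : 1 ≤ r) (hs : 1 ≤ s) :
    ∃ (L : Type) (_ : Lattice L) (_ : Fintype L) (_ : BoundedOrder L),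
      {a : L | IsAtom a}.ncard = r ∧ {c : L | IsCoatom c}.ncard = s ∧
      ∀ F : Finset (L × L), (∀ p ∈ F, IsAtom p.1 ∧ IsCoatom p.2) →
        ({x : L | ∃ a, IsAtom a ∧ ∃ c, IsCoatom c ∧ a ≤ x ∧ x ≤ c} ⊆
          ⋃ p ∈ F, Set.Icc p.1 p.2) →
        r * s ≤ F.card := by
  have : Nonempty (Fin r) := ⟨⟨0, hr⟩⟩
  have : Nonempty (Fin s) := ⟨⟨0, hs⟩⟩
  refine ⟨GridLattice (Fin r) (Fin s), inferInstance, Fintype.ofFinite _, inferInstance, ?_, ?_, ?_⟩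
  · simpa using GridLattice.ncard_isAtom (α := Fin r) (β := Fin s)
  · simpa using GridLattice.ncard_isCoatom (α := Fin r) (β := Fin s)
  · intro F hF hcover
    have hcard : (Finset.univ : Finset (Fin r × Fin s)).card ≤ F.card :=
      Finset.card_le_card_of_injOn (fun p => (.atom p.1, .coatom p.2))
        (fun p _ => GridLattice.mem_of_cover hF hcover p.1 p.2) (fun p _ q _ h => by
          simpa [Prod.ext_iff] using h)
    simpa using hcard
end
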